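/- Let U be a filtered k-algebra, let g = {g_1,…,g_t} be mutually commuting elements of U whose principal symbols ḡ_1,…,ḡ_t form a complete intersection for gr U, let μ_1,…,μ_t ∈ U with deg g_i > deg μ_i for all i, set d_i = deg g_i, μ = (μ_1,…,μ_t) and I_μ = U(g_1−μ_1)+…+U(g_t−μ_t), and assume the elements g_i−μ_i (i=1,…,t) mutually commute. Then: (1) I_μ ∩ U_m = Σ_{i=1}^t U_{m−d_i}(g_i−μ_i) for every m; (2) gr I_μ = (gr U)ḡ_1 + … + (gr U)ḡ_t, and in particular I_μ ≠ U; (3) there exists a simple left U-module M generated by an element m ∈ M such that g_i·m = μ_i·m for every i; (4) for every character ν of Γ = k[g_1,…,g_t] there exists a simple left U-module M generated by an element m ∈ M such that γ·m = ν(γ)m for every γ ∈ Γ. -/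

import Mathlib

open scoped TensorProduct

noncomputable section

universe u v w

/-- A sequence `g 0, …, g (t-1)` in a commutative ring is *regular* if for each `i`
the class of `g i` in the quotient by the ideal generated by the previous elements
is neither a zero divisor nor invertible. -/
def IsRegularSequence {Λ : Type u} [CommRing Λ] {t : ℕ} (g : Fin t → Λ) : Prop :=
  ∀ i : Fin t,
    ((∀ x : Λ, g i * x ∈ Ideal.span (g '' {j | j < i}) → x ∈ Ideal.span (g '' {j | j < i})) ∧
      Ideal.span (g '' {j | j ≤ i}) ≠ ⊤)

/-- The `i`-th differential of the Koszul complex of a sequence `g` of elements in a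
`k`-algebra `U`, where the `i`-th term of the complex is the free `U`-module on the
`i`-element subsets of `Fin t` (a model of `U ⊗ Λ^i k^t`), with
`d (u ⊗ e_{j₁} ∧ … ∧ e_{jᵢ}) = Σ (-1)^(m-1) (u * g jₘ) ⊗ e_{j₁} ∧ … ∧ ê_{jₘ} ∧ … ∧ e_{jᵢ}`. -/
noncomputable def koszulD (k : Type u) {U : Type v} [CommRing k] [Ring U] [Algebra k U]
    {t : ℕ} (g : Fin t → U) (i : ℕ) :
    ({s : Finset (Fin t) // s.card = i + 1} →₀ U) →ₗ[k] ({s : Finset (Fin t) // s.card = i} →₀ U) :=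
  Finsupp.lsum k fun s =>
    ∑ j ∈ s.1.attach,
      (Finsupp.lsingle (R := k)
          (⟨s.1.erase j.1, by simp [Finset.card_erase_of_mem j.2, s.2]⟩ :
            {s : Finset (Fin t) // s.card = i})).comp
        (LinearMap.mulRight k (((-1 : U) ^ (s.1.filter fun a => a < j.1).card) * g j.1))

/-- A sequence `g` of (mutually commuting) elements of a `k`-algebra `U` is a
*complete intersection for `U`* if the Koszul homology `H_i(g, U)` vanishes for `i ≠ 0`
and `H_0(g, U) = U/(U g 0 + … + U g (t-1)) ≠ 0`. -/
def IsCompleteIntersection (k : Type u) {U : Type v} [CommRing k] [Ring U] [Algebra k U]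
    {t : ℕ} (g : Fin t → U) : Prop :=
  (∀ i : ℕ, LinearMap.ker (koszulD k g i) = LinearMap.range (koszulD k g (i + 1))) ∧
    Submodule.span U (Set.range g) ≠ ⊤

/-- `F` is an increasing exhausting algebra filtration of the `k`-algebra `U`,
with `F 0 = k·1`. -/
structure IsAlgebraFiltration {k : Type u} {U : Type v} [CommRing k] [Ring U] [Algebra k U]
    (F : ℕ → Submodule k U) : Prop where
  zero : F 0 = 1
  mono : Monotone F
  mul_le : ∀ i j, F i * F j ≤ F (i + j)
  exhaustive : (⨆ i, F i) = ⊤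

/-- `(B, ℬ, π)` is a realization of the associated graded algebra
`gr U = ⊕_{i≥0} U_i/U_{i-1}` of the filtered algebra `(U, F)`: `B` is a graded `k`-algebra
with grading `ℬ` and `π i : F i →ₗ[k] B` is the canonical projection of `F i` onto the
`i`-th graded piece `ℬ i ≅ F i / F (i-1)`; for `u ∈ F i \ F (i-1)` the element `π i u` is
the principal symbol `ū` of `u`. -/
structure IsAssociatedGraded {k : Type u} {U : Type v} {B : Type w} [CommRing k]
    [Ring U] [Algebra k U] [Ring B] [Algebra k B]
    (F : ℕ → Submodule k U) (ℬ : ℕ → Submodule k B) (π : ∀ i : ℕ, F i →ₗ[k] B) : Prop where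
  range_eq : ∀ i, LinearMap.range (π i) = ℬ i
  injective_zero : Function.Injective (π 0)
  ker_succ : ∀ (i : ℕ) (x : F (i + 1)), π (i + 1) x = 0 ↔ (x : U) ∈ F i
  map_one : ∀ h : (1 : U) ∈ F 0, π 0 ⟨1, h⟩ = 1
  map_mul : ∀ (i j : ℕ) (x : F i) (y : F j) (h : (x : U) * (y : U) ∈ F (i + j)),
    π (i + j) ⟨(x : U) * (y : U), h⟩ = π i x * π j y

/-- The associated graded (left) ideal `gr I ⊆ gr U` of a left ideal `I` of a filtered
algebra `U`: the span of the principal symbols of the elements of `I`. -/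
noncomputable def grLeftIdeal {k : Type u} {U : Type v} {B : Type w} [CommRing k]
    [Ring U] [Algebra k U] [Ring B] [Algebra k B]
    (F : ℕ → Submodule k U) (π : ∀ i : ℕ, F i →ₗ[k] B) (I : Submodule U U) :
    Submodule k B :=
  ⨆ i, Submodule.map (π i) ((I.restrictScalars k).comap (F i).subtype)

section AssociatedGraded

variable {k : Type u} {U : Type v} {B : Type w} [CommRing k] [Ring U] [Algebra k U]
  [Ring B] [Algebra k B]

/-- The filtration `F` extended to integer indices by zero. -/
def intFiltration (F : ℕ → Submodule k U) : ℤ → Submodule k U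
  | .ofNat n => F n
  | .negSucc _ => ⊥

/-- The relation "`b` is the class of `u ∈ F z` in degree `z`", as a submodule of `U × B`. -/
def symbolGraph (F : ℕ → Submodule k U) (π : ∀ i : ℕ, F i →ₗ[k] B) : ℤ → Submodule k (U × B)
  | .ofNat n => LinearMap.range ((F n).subtype.prod (π n))
  | .negSucc _ => ⊥

/-- The projection of a graded algebra to an integer degree (zero in negative degrees). -/
def intProj (ℬ : ℕ → Submodule k B) [GradedAlgebra ℬ] : ℤ → B →ₗ[k] B
  | .ofNat n => GradedAlgebra.proj ℬ n
  | .negSucc _ => 0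

variable {F : ℕ → Submodule k U} {ℬ : ℕ → Submodule k B} {π : ∀ i : ℕ, F i →ₗ[k] B}

lemma mem_intFiltration_natCast {n : ℕ} {u : U} : u ∈ intFiltration F n ↔ u ∈ F n := Iff.rfl

lemma mem_symbolGraph_natCast {n : ℕ} {u : U} {b : B} :
    (u, b) ∈ symbolGraph F π n ↔ ∃ h : u ∈ F n, π n ⟨u, h⟩ = b := by
  change (u, b) ∈ LinearMap.range ((F n).subtype.prod (π n)) ↔ _
  constructor
  · rintro ⟨x, hx⟩
    obtain ⟨rfl, rfl⟩ := Prod.ext_iff.1 hx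
    exact ⟨x.2, rfl⟩
  · rintro ⟨h, rfl⟩
    exact ⟨⟨u, h⟩, rfl⟩

lemma mem_symbolGraph_negSucc {n : ℕ} {u : U} {b : B} :
    (u, b) ∈ symbolGraph F π (.negSucc n) ↔ u = 0 ∧ b = 0 := by
  change (u, b) ∈ (⊥ : Submodule k (U × B)) ↔ _
  simp

lemma mem_intFiltration_negSucc {n : ℕ} {u : U} :
    u ∈ intFiltration F (.negSucc n) ↔ u = 0 := Submodule.mem_bot k

lemma intFiltration_mono (hF : IsAlgebraFiltration F) : Monotone (intFiltration F) := by
  intro a b hab u hu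
  cases a with
  | negSucc m =>
    rw [mem_intFiltration_negSucc.1 hu]
    exact zero_mem _
  | ofNat m =>
    cases b with
    | negSucc n => exact absurd hab (by simp only [Int.ofNat_eq_natCast]; omega)
    | ofNat n => exact hF.mono (by simpa using hab) hu

lemma mem_intFiltration_iff_exists {z : ℤ} {u : U} :
    u ∈ intFiltration F z ↔ ∃ b, (u, b) ∈ symbolGraph F π z := by
  cases z with
  | negSucc n => simp [mem_intFiltration_negSucc, mem_symbolGraph_negSucc]
  | ofNat n => simp [mem_symbolGraph_natCast, mem_intFiltration_natCast]

lemma symbolGraph_unique {z : ℤ} {u : U} {b b' : B} (h : (u, b) ∈ symbolGraph F π z)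
    (h' : (u, b') ∈ symbolGraph F π z) : b = b' := by
  cases z with
  | negSucc n => rw [(mem_symbolGraph_negSucc.1 h).2, (mem_symbolGraph_negSucc.1 h').2]
  | ofNat n =>
    obtain ⟨_, rfl⟩ := mem_symbolGraph_natCast.1 h
    obtain ⟨_, rfl⟩ := mem_symbolGraph_natCast.1 h'
    rfl

lemma symbolGraph_zero_iff (hF : IsAlgebraFiltration F) [GradedAlgebra ℬ]
    (hπ : IsAssociatedGraded F ℬ π) {z : ℤ} {u : U} :
    (u, (0 : B)) ∈ symbolGraph F π z ↔ u ∈ intFiltration F (z - 1) := by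
  rcases z with (_ | n) | n
  · change _ ↔ u ∈ intFiltration F (.negSucc 0)
    rw [mem_intFiltration_negSucc]
    simp only [Int.ofNat_eq_natCast]
    rw [mem_symbolGraph_natCast]
    constructor
    · rintro ⟨h, h0⟩
      exact congrArg Subtype.val (hπ.injective_zero (h0.trans (map_zero _).symm))
    · rintro rfl
      exact ⟨zero_mem _, map_zero (π 0)⟩
  · rw [show (Int.ofNat (n + 1) - 1 : ℤ) = (n : ℤ) by simp]
    simp only [Int.ofNat_eq_natCast]
    rw [mem_symbolGraph_natCast, mem_intFiltration_natCast]
    exact ⟨fun ⟨h, h0⟩ => (hπ.ker_succ n ⟨u, h⟩).1 h0,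
      fun h => ⟨hF.mono n.le_succ h, (hπ.ker_succ n ⟨u, _⟩).2 h⟩⟩
  · rw [show (Int.negSucc n - 1 : ℤ) = Int.negSucc (n + 1) by omega,
      mem_intFiltration_negSucc, mem_symbolGraph_negSucc]
    simp

lemma symbolGraph_mul (hF : IsAlgebraFiltration F) (hπ : IsAssociatedGraded F ℬ π)
    {a a' : ℤ} {u u' : U} {b b' : B} (h : (u, b) ∈ symbolGraph F π a)
    (h' : (u', b') ∈ symbolGraph F π a') :
    (u * u', b * b') ∈ symbolGraph F π (a + a') := by
  cases a with
  | negSucc n =>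
    obtain ⟨rfl, rfl⟩ := mem_symbolGraph_negSucc.1 h
    simp only [zero_mul]
    exact zero_mem _
  | ofNat n =>
    cases a' with
    | negSucc n =>
      obtain ⟨rfl, rfl⟩ := mem_symbolGraph_negSucc.1 h'
      simp only [mul_zero]
      exact zero_mem _
    | ofNat m =>
      obtain ⟨hu, rfl⟩ := mem_symbolGraph_natCast.1 h
      obtain ⟨hu', rfl⟩ := mem_symbolGraph_natCast.1 h'
      exact mem_symbolGraph_natCast.2 ⟨hF.mul_le n m (Submodule.mul_mem_mul hu hu'),
        hπ.map_mul n m ⟨u, hu⟩ ⟨u', hu'⟩ _⟩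

lemma sum_mem_symbolGraph {ι : Type*} [Fintype ι] {z : ℤ} {u : ι → U} {b : ι → B}
    (h : ∀ i, (u i, b i) ∈ symbolGraph F π z) : (∑ i, u i, ∑ i, b i) ∈ symbolGraph F π z := by
  have hsum : ∑ i, (u i, b i) ∈ symbolGraph F π z := sum_mem fun i _ => h i
  rwa [← Prod.mk.eta (p := ∑ i, (u i, b i)), Prod.fst_sum, Prod.snd_sum] at hsum

lemma intProj_of_mem_symbolGraph [GradedAlgebra ℬ] (hπ : IsAssociatedGraded F ℬ π)
    {z : ℤ} {u : U} {b : B} (h : (u, b) ∈ symbolGraph F π z) : intProj ℬ z b = b := by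
  cases z with
  | negSucc n =>
    rw [(mem_symbolGraph_negSucc.1 h).2, map_zero]
  | ofNat n =>
    obtain ⟨hu, rfl⟩ := mem_symbolGraph_natCast.1 h
    exact DirectSum.decompose_of_mem_same ℬ (hπ.range_eq n ▸ LinearMap.mem_range_self _ _)

lemma intProj_add_mul [GradedAlgebra ℬ] {a : ℤ} {e : ℕ} {x : B} (hx : x ∈ ℬ e) (c : B) :
    intProj ℬ (a + e) (c * x) = intProj ℬ a c * x := by
  cases a with
  | ofNat n =>
    exact DirectSum.coe_decompose_mul_add_of_right_mem ℬ hx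
  | negSucc n =>
    rw [show intProj ℬ (.negSucc n) = 0 from rfl, LinearMap.zero_apply, zero_mul]
    rcases h : (Int.negSucc n + e : ℤ) with m | m
    · exact DirectSum.coe_decompose_mul_of_right_mem_of_not_le ℬ hx
        (by simp only [Int.ofNat_eq_natCast] at h; omega)
    · rfl

end AssociatedGraded

section Koszul

variable {k : Type u} {U : Type v} [CommRing k] [Ring U] [Algebra k U] {t : ℕ}

lemma koszulD_single (g : Fin t → U) (i : ℕ) (s : {s : Finset (Fin t) // s.card = i + 1})
    (x : U) (s' : {s : Finset (Fin t) // s.card = i}) :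
    koszulD k g i (Finsupp.single s x) s' =
      ∑ j ∈ s.1, if s.1.erase j = s'.1 then
        x * ((-1 : U) ^ (s.1.filter fun a => a < j).card * g j) else 0 := by
  rw [← Finset.sum_attach]
  simp only [koszulD, Finsupp.lsum_single, LinearMap.sum_apply, LinearMap.comp_apply,
    LinearMap.mulRight_apply, Finsupp.lsingle_apply, Finsupp.finsetSum_apply,
    Finsupp.single_apply, Subtype.ext_iff]

lemma koszulD_one_eq_antisymm (g : Fin t → U)
    (h : {s : Finset (Fin t) // s.card = 1 + 1} →₀ U) :
    ∃ c : Fin t → Fin t → U, (∀ i j, c i j = -c j i) ∧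
      ∀ i, koszulD k g 1 h ⟨{i}, Finset.card_singleton i⟩ = ∑ j, c i j * g j := by
  induction h using Finsupp.induction_linear with
  | zero => exact ⟨0, by simp, by simp⟩
  | add f₁ f₂ h₁ h₂ =>
    obtain ⟨c₁, a₁, e₁⟩ := h₁
    obtain ⟨c₂, a₂, e₂⟩ := h₂
    refine ⟨c₁ + c₂, fun i j => ?_, fun i => ?_⟩
    · simp only [Pi.add_apply]
      rw [a₁ i j, a₂ i j]
      abel
    · simp [e₁, e₂, add_mul, Finset.sum_add_distrib]
  | single s x =>
    obtain ⟨s, hs⟩ := s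
    obtain ⟨p, q, hpq, rfl⟩ : ∃ p q, p < q ∧ s = {p, q} := by
      obtain ⟨p, q, hne, rfl⟩ := Finset.card_eq_two.1 hs
      rcases hne.lt_or_gt with h | h
      · exact ⟨p, q, h, rfl⟩
      · exact ⟨q, p, h, Finset.pair_comm _ _⟩
    refine ⟨fun i j => (if i = q ∧ j = p then x else 0) - (if i = p ∧ j = q then x else 0),
      fun i j => ?_, fun i => ?_⟩
    · simp only [and_comm (a := j = q), and_comm (a := j = p), neg_sub]
    · have hp : ({p, q} : Finset (Fin t)).erase p = {q} := by
        ext a; simp; grind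
      have hq : ({p, q} : Finset (Fin t)).erase q = {p} := by
        ext a; simp; grind
      have hfp : ({p, q} : Finset (Fin t)).filter (fun a => a < p) = ∅ := by
        ext a; simp; grind
      have hfq : ({p, q} : Finset (Fin t)).filter (fun a => a < q) = {p} := by
        ext a; simp; grind
      rw [koszulD_single, Finset.sum_pair hpq.ne]
      simp only [hp, hq, hfp, hfq, sub_mul, Finset.sum_sub_distrib, ite_and, ite_mul, zero_mul,
        Finset.singleton_inj, eq_comm (a := i)]
      by_cases h₁ : q = i <;> by_cases h₂ : p = i <;> simp [h₁, h₂]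

/-- Vanishing of the first Koszul homology, spelled out: every relation is a combination of
the trivial ones. -/
lemma IsCompleteIntersection.exists_antisymm {g : Fin t → U} (hg : IsCompleteIntersection k g)
    {b : Fin t → U} (hb : ∑ i, b i * g i = 0) :
    ∃ c : Fin t → Fin t → U, (∀ i j, c i j = -c j i) ∧ ∀ i, b i = ∑ j, c i j * g j := by
  classical
  let f : {s : Finset (Fin t) // s.card = 0 + 1} →₀ U :=
    ∑ i, Finsupp.single ⟨{i}, Finset.card_singleton i⟩ (b i)
  have hf : f ∈ LinearMap.ker (koszulD k g 0) := by
    rw [LinearMap.mem_ker]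
    ext ⟨s, hs⟩
    obtain rfl := Finset.card_eq_zero.1 hs
    simp only [f, map_sum, Finsupp.finsetSum_apply, koszulD_single]
    simpa [Finset.filter_singleton] using hb
  rw [hg.1 0] at hf
  obtain ⟨h, hh⟩ := hf
  obtain ⟨c, hc, e⟩ := koszulD_one_eq_antisymm (k := k) g h
  refine ⟨c, hc, fun i => ?_⟩
  rw [← e]
  have := DFunLike.congr_fun hh ⟨{i}, Finset.card_singleton i⟩
  refine Eq.trans ?_ this.symm
  simp [f, Finsupp.finsetSum_apply, Finsupp.single_apply]

end Koszul

section Deformation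

variable {k : Type u} {U : Type v} {B : Type w} [Field k] [Ring U] [Algebra k U]
  [Ring B] [Algebra k B] {F : ℕ → Submodule k U} {ℬ : ℕ → Submodule k B} [GradedAlgebra ℬ]
  {π : ∀ i : ℕ, F i →ₗ[k] B} {t : ℕ} {d : Fin t → ℕ}

lemma exists_linear_lift (hπ : IsAssociatedGraded F ℬ π) (z : ℤ) :
    ∃ σ : B →ₗ[k] U, ∀ b, (σ b, intProj ℬ z b) ∈ symbolGraph F π z := by
  cases z with
  | negSucc n => exact ⟨0, fun b => zero_mem _⟩
  | ofNat n =>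
    obtain ⟨s, hs⟩ := (π n).rangeRestrict.exists_rightInverse_of_surjective
      (π n).range_rangeRestrict
    have hmem : ∀ b, GradedAlgebra.proj ℬ n b ∈ LinearMap.range (π n) := fun b => by
      rw [hπ.range_eq]
      exact SetLike.coe_mem _
    refine ⟨(F n).subtype ∘ₗ s ∘ₗ (GradedAlgebra.proj ℬ n).codRestrict _ hmem, fun b => ?_⟩
    exact mem_symbolGraph_natCast.2
      ⟨(s _).2, congrArg Subtype.val (LinearMap.congr_fun hs ⟨_, hmem b⟩)⟩

lemma exists_mem_intFiltration (hF : IsAlgebraFiltration F) (u : U) : ∃ n : ℕ, u ∈ F n :=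
  (Submodule.mem_iSup_of_directed F hF.mono.directed_le).1 (hF.exhaustive ▸ Submodule.mem_top)

/-- A proper left ideal annihilates a generator of some simple module. -/
lemma exists_simple_of_ne_top {I : Submodule U U} (hI : I ≠ ⊤) :
    ∃ (M : Type v) (_ : AddCommGroup M) (_ : Module U M) (m : M),
      IsSimpleModule U M ∧ Submodule.span U {m} = ⊤ ∧ ∀ x ∈ I, x • m = 0 := by
  obtain ⟨J, hJ, hIJ⟩ := Ideal.exists_le_maximal I hI
  refine ⟨U ⧸ J, inferInstance, inferInstance, Submodule.Quotient.mk 1, ?_, ?_, fun x hx => ?_⟩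
  · exact isSimpleModule_iff_isCoatom.2 hJ.out
  · refine Submodule.eq_top_iff'.2 fun x => ?_
    obtain ⟨y, rfl⟩ := Submodule.Quotient.mk_surjective J x
    refine Submodule.mem_span_singleton.2 ⟨y, ?_⟩
    rw [← Submodule.Quotient.mk_smul, smul_eq_mul, mul_one]
  · rw [← Submodule.Quotient.mk_smul, smul_eq_mul, mul_one]
    exact (Submodule.Quotient.mk_eq_zero J).2 (hIJ hx)

lemma sub_mem_symbolGraph (hF : IsAlgebraFiltration F) (hπ : IsAssociatedGraded F ℬ π)
    {n : ℕ} (hn : 0 < n) {x y : U} (hx : x ∈ F n) (hy : y ∈ F (n - 1)) :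
    (x - y, π n ⟨x, hx⟩) ∈ symbolGraph F π n := by
  have hy0 : (y, (0 : B)) ∈ symbolGraph F π n := by
    rw [symbolGraph_zero_iff hF hπ, ← Nat.cast_pred hn]
    exact hy
  simpa using sub_mem (mem_symbolGraph_natCast.2 ⟨hx, rfl⟩) hy0

lemma smul_eq_of_character {g : Fin t → U} (ν : Algebra.adjoin k (Set.range g) →ₐ[k] k)
    {M : Type*} [AddCommGroup M] [Module U M] {m : M}
    (hm : ∀ i, g i • m =
      algebraMap k U (ν ⟨g i, Algebra.subset_adjoin ⟨i, rfl⟩⟩) • m)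
    (γ : Algebra.adjoin k (Set.range g)) : (γ : U) • m = algebraMap k U (ν γ) • m := by
  obtain ⟨γ, hγ⟩ := γ
  induction hγ using Algebra.adjoin_induction with
  | mem x hx =>
    obtain ⟨i, rfl⟩ := hx
    exact hm i
  | algebraMap r =>
    have : (⟨algebraMap k U r, Subalgebra.algebraMap_mem _ r⟩ :
      Algebra.adjoin k (Set.range g)) = algebraMap k _ r := rfl
    rw [this, ν.commutes]
    rfl
  | add x y hx hy ihx ihy =>
    have : (⟨x + y, add_mem hx hy⟩ : Algebra.adjoin k (Set.range g)) =
      ⟨x, hx⟩ + ⟨y, hy⟩ := rfl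
    rw [this, map_add, map_add, add_smul, ← ihx, ← ihy, ← add_smul]
    rfl
  | mul x y hx hy ihx ihy =>
    have : (⟨x * y, mul_mem hx hy⟩ : Algebra.adjoin k (Set.range g)) =
      ⟨x, hx⟩ * ⟨y, hy⟩ := rfl
    simp only at ihx ihy ⊢
    rw [this, map_mul, map_mul, mul_smul, ihy, ← mul_smul, ← Algebra.commutes, mul_smul, ihx,
      ← mul_smul, Algebra.commutes]

variable [CharZero k]

/-- If the principal symbols of the `h i` form a complete intersection, then a combination of
the `h i` whose value has smaller degree than expected can be rewritten with coefficients of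
smaller degree. -/
lemma exists_lower_coeff (hF : IsAlgebraFiltration F) (hπ : IsAssociatedGraded F ℬ π)
    {h : Fin t → U} {a : Fin t → B} (ha : ∀ i, (h i, a i) ∈ symbolGraph F π (d i))
    (hcomm : ∀ i j, Commute (h i) (h j)) (hCI : IsCompleteIntersection k a) {z : ℤ}
    {u : Fin t → U} (hu : ∀ i, u i ∈ intFiltration F (z - d i))
    (hsum : ∑ i, u i * h i ∈ intFiltration F (z - 1)) :
    ∃ u' : Fin t → U, (∀ i, u' i ∈ intFiltration F (z - 1 - d i)) ∧
      ∑ i, u' i * h i = ∑ i, u i * h i := by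
  have haB : ∀ i, a i ∈ ℬ (d i) := fun i => by
    obtain ⟨hi, hi'⟩ := mem_symbolGraph_natCast.1 (ha i)
    rw [← hi', ← hπ.range_eq]
    exact LinearMap.mem_range_self _ _
  choose b hb using fun i => (mem_intFiltration_iff_exists (π := π)).1 (hu i)
  have hrel : ∑ i, b i * a i = 0 := by
    refine symbolGraph_unique (F := F) (π := π) (z := z) (u := ∑ i, u i * h i) ?_
      ((symbolGraph_zero_iff hF hπ).2 hsum)
    refine sum_mem_symbolGraph fun i => ?_
    simpa using symbolGraph_mul hF hπ (hb i) (ha i)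
  obtain ⟨c, hc, hbc⟩ := hCI.exists_antisymm hrel
  choose σ hσ using exists_linear_lift hπ
  let C : Fin t → Fin t → U := fun i j => σ (z - d i - d j) (c i j)
  have hC : ∀ i j, C i j = -C j i := fun i j => by
    simp only [C]
    rw [hc i j, map_neg, sub_right_comm]
  have hCsum : ∑ i, (∑ j, C i j * h j) * h i = 0 := by
    have hneg : ∑ i, (∑ j, C i j * h j) * h i = -∑ i, (∑ j, C i j * h j) * h i := by
      conv_lhs => simp only [Finset.sum_mul]
      rw [Finset.sum_comm, ← Finset.sum_neg_distrib]
      refine Finset.sum_congr rfl fun i _ => ?_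
      rw [Finset.sum_mul, ← Finset.sum_neg_distrib]
      refine Finset.sum_congr rfl fun j _ => ?_
      rw [hC j i, mul_assoc, mul_assoc, (hcomm i j).eq, neg_mul]
    have : IsAddTorsionFree U := IsAddTorsionFree.of_isTorsionFree k U
    exact self_eq_neg.1 hneg
  refine ⟨fun i => u i - ∑ j, C i j * h j, fun i => ?_, ?_⟩
  · rw [sub_right_comm, ← symbolGraph_zero_iff hF hπ]
    have hproj : ∑ j, intProj ℬ (z - d i - d j) (c i j) * a j = b i := by
      rw [← intProj_of_mem_symbolGraph hπ (hb i)]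
      conv_rhs => rw [hbc i, map_sum]
      refine Finset.sum_congr rfl fun j _ => ?_
      rw [← intProj_add_mul (haB j), sub_add_cancel]
    have hCb : (∑ j, C i j * h j, b i) ∈ symbolGraph F π (z - d i) := by
      rw [← hproj]
      refine sum_mem_symbolGraph fun j => ?_
      simpa using symbolGraph_mul hF hπ (hσ (z - d i - d j) (c i j)) (ha j)
    simpa using sub_mem (hb i) hCb
  · simp only [sub_mul, Finset.sum_sub_distrib, hCsum, sub_zero]

lemma exists_coeff_of_mem_span (hF : IsAlgebraFiltration F) (hπ : IsAssociatedGraded F ℬ π)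
    {h : Fin t → U} {a : Fin t → B} (ha : ∀ i, (h i, a i) ∈ symbolGraph F π (d i))
    (hcomm : ∀ i j, Commute (h i) (h j)) (hCI : IsCompleteIntersection k a) {m : ℕ} {x : U}
    (hx : x ∈ Submodule.span U (Set.range h)) (hxm : x ∈ F m) :
    ∃ u : Fin t → U, (∀ i, u i ∈ intFiltration F (m - d i)) ∧ ∑ i, u i * h i = x := by
  obtain ⟨u, hu⟩ := (Submodule.mem_span_range_iff_exists_fun U).1 hx
  simp only [smul_eq_mul] at hu
  choose n hn using fun i => exists_mem_intFiltration hF (u i)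
  have key : ∀ N : ℕ, (∃ u : Fin t → U, (∀ i, u i ∈ intFiltration F (m + N - d i)) ∧
      ∑ i, u i * h i = x) →
      ∃ u : Fin t → U, (∀ i, u i ∈ intFiltration F (m - d i)) ∧ ∑ i, u i * h i = x := by
    intro N
    induction N with
    | zero => simp
    | succ N ih =>
      rintro ⟨v, hv, hvx⟩
      apply ih
      obtain ⟨u', hu', e⟩ := exists_lower_coeff hF hπ ha hcomm hCI hv
        (hvx ▸ intFiltration_mono hF (a := m) (by push_cast; omega) hxm)
      refine ⟨u', fun i => ?_, e.trans hvx⟩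
      convert hu' i using 2
      push_cast
      ring
  refine key (∑ i, (n i + d i)) ⟨u, fun i => ?_, hu⟩
  have hle : n i + d i ≤ ∑ i, (n i + d i) :=
    Finset.single_le_sum (f := fun i => n i + d i) (fun _ _ => Nat.zero_le _)
      (Finset.mem_univ i)
  exact intFiltration_mono hF (a := n i) (by zify at hle ⊢; omega) (hn i)

lemma span_inf_filtration (hF : IsAlgebraFiltration F) (hπ : IsAssociatedGraded F ℬ π)
    {h : Fin t → U} {a : Fin t → B} (ha : ∀ i, (h i, a i) ∈ symbolGraph F π (d i))
    (hcomm : ∀ i j, Commute (h i) (h j)) (hCI : IsCompleteIntersection k a) (m : ℕ) :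
    (Submodule.span U (Set.range h)).restrictScalars k ⊓ F m =
      ⨆ i : Fin t, if d i ≤ m then
        Submodule.map (LinearMap.mulRight k (h i)) (F (m - d i)) else ⊥ := by
  apply le_antisymm
  · rintro x ⟨hx, hxm⟩
    obtain ⟨u, hu, rfl⟩ := exists_coeff_of_mem_span hF hπ ha hcomm hCI hx hxm
    refine sum_mem fun i _ => Submodule.mem_iSup_of_mem i ?_
    split_ifs with hi
    · refine ⟨u i, ?_, rfl⟩
      have := hu i
      rwa [← Nat.cast_sub hi] at this
    · obtain ⟨n, hn⟩ : ∃ n, (m - d i : ℤ) = .negSucc n :=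
        Int.eq_negSucc_of_lt_zero (by omega)
      have := hu i
      rw [hn, mem_intFiltration_negSucc] at this
      simp [this]
  · refine iSup_le fun i => ?_
    split_ifs with hi
    · rintro _ ⟨u, hu, rfl⟩
      refine ⟨Submodule.smul_mem _ u (Submodule.subset_span ⟨i, rfl⟩), ?_⟩
      obtain ⟨hi', -⟩ := mem_symbolGraph_natCast.1 (ha i)
      have := hF.mul_le _ _ (Submodule.mul_mem_mul hu hi')
      rwa [Nat.sub_add_cancel hi] at this
    · exact bot_le

lemma grLeftIdeal_span (hF : IsAlgebraFiltration F) (hπ : IsAssociatedGraded F ℬ π)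
    {h : Fin t → U} {a : Fin t → B} (ha : ∀ i, (h i, a i) ∈ symbolGraph F π (d i))
    (hcomm : ∀ i j, Commute (h i) (h j)) (hCI : IsCompleteIntersection k a) :
    grLeftIdeal F π (Submodule.span U (Set.range h)) =
      (Submodule.span B (Set.range a)).restrictScalars k := by
  apply le_antisymm
  · refine iSup_le fun m => ?_
    rintro _ ⟨⟨x, hxm⟩, hx, rfl⟩
    obtain ⟨u, hu, rfl⟩ := exists_coeff_of_mem_span hF hπ ha hcomm hCI hx hxm
    choose b hb using fun i => (mem_intFiltration_iff_exists (π := π)).1 (hu i)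
    have hsymb : (∑ i, u i * h i, ∑ i, b i * a i) ∈ symbolGraph F π m := by
      refine sum_mem_symbolGraph fun i => ?_
      simpa using symbolGraph_mul hF hπ (hb i) (ha i)
    rw [symbolGraph_unique (mem_symbolGraph_natCast.2 ⟨hxm, rfl⟩) hsymb]
    exact sum_mem fun i _ => Submodule.smul_mem _ (b i) (Submodule.subset_span ⟨i, rfl⟩)
  · intro x hx
    obtain ⟨b, rfl⟩ := (Submodule.mem_span_range_iff_exists_fun B).1 hx
    refine sum_mem fun i _ => ?_
    induction b i using DirectSum.Decomposition.inductionOn ℬ with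
    | zero => simp
    | add x y hx hy =>
      rw [add_smul]
      exact add_mem hx hy
    | @homogeneous n x =>
      obtain ⟨u, hu⟩ : (x : B) ∈ LinearMap.range (π n) := by
        rw [hπ.range_eq]
        exact x.2
      have hmul := symbolGraph_mul hF hπ (mem_symbolGraph_natCast.2 ⟨u.2, hu⟩) (ha i)
      rw [← Nat.cast_add] at hmul
      obtain ⟨hm, e⟩ := mem_symbolGraph_natCast.1 hmul
      rw [smul_eq_mul, ← e]
      have hspan : (u : U) * h i ∈ Submodule.span U (Set.range h) :=
        Submodule.smul_mem _ (u : U) (Submodule.subset_span ⟨i, rfl⟩)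
      exact Submodule.mem_iSup_of_mem (n + d i) (Submodule.mem_map_of_mem hspan)

lemma span_ne_top (hF : IsAlgebraFiltration F) (hπ : IsAssociatedGraded F ℬ π)
    {h : Fin t → U} {a : Fin t → B} (ha : ∀ i, (h i, a i) ∈ symbolGraph F π (d i))
    (hcomm : ∀ i j, Commute (h i) (h j)) (hCI : IsCompleteIntersection k a) :
    Submodule.span U (Set.range h) ≠ ⊤ := by
  intro htop
  have h1 : (1 : U) ∈ F 0 := Submodule.one_le.1 hF.zero.ge
  have : (1 : B) ∈ (Submodule.span B (Set.range a)).restrictScalars k := by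
    rw [← grLeftIdeal_span hF hπ ha hcomm hCI, htop]
    refine Submodule.mem_iSup_of_mem 0 ⟨(⟨1, h1⟩ : F 0), Submodule.mem_top, hπ.map_one h1⟩
  exact hCI.2 (Ideal.eq_top_of_isUnit_mem _ this isUnit_one)

end Deformation

/-- Let `U` be a filtered `k`-algebra, `g = {g 1, …, g t}` mutually
commuting elements of `U` whose principal symbols form a complete intersection for `gr U`,
`μ i ∈ U` with `deg (g i) = d i > deg (μ i)`, `I_μ = U(g 1 − μ 1) + … + U(g t − μ t)`, and
assume the elements `g i − μ i` mutually commute. Then: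
(1) `I_μ ∩ U_m = Σ_i U_{m − d i}·(g i − μ i)` for every `m`;
(2) `gr I_μ = (gr U) ḡ 1 + … + (gr U) ḡ t`, and in particular `I_μ ≠ U`;
(3) there is a simple left `U`-module `M` generated by `m ∈ M` with `g i • m = μ i • m`;
(4) for every character `ν` of `Γ = k[g 1, …, g t]` there is a simple left `U`-module `M`
generated by `m ∈ M` with `γ • m = ν(γ) • m` for all `γ ∈ Γ`. -/
theorem statement8 {k : Type u} {U : Type v} {B : Type w} [Field k] [IsAlgClosed k]
    [CharZero k] [Ring U] [Algebra k U] [Ring B] [Algebra k B]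
    (F : ℕ → Submodule k U) (hF : IsAlgebraFiltration F)
    (ℬ : ℕ → Submodule k B) [GradedAlgebra ℬ] (π : ∀ i : ℕ, F i →ₗ[k] B)
    (hπ : IsAssociatedGraded F ℬ π)
    {t : ℕ} (g : Fin t → U) (hcomm : ∀ i j, Commute (g i) (g j))
    (d : Fin t → ℕ) (hdF : ∀ i, g i ∈ F (d i))
    (hne : ∀ i, π (d i) ⟨g i, hdF i⟩ ≠ 0)
    (hCI : IsCompleteIntersection k (fun i => π (d i) ⟨g i, hdF i⟩))
    (μ : Fin t → U) (hdpos : ∀ i, 0 < d i) (hμ : ∀ i, μ i ∈ F (d i - 1))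
    (hcommμ : ∀ i j, Commute (g i - μ i) (g j - μ j)) :
    (∀ m : ℕ,
        (Submodule.span U (Set.range fun i => g i - μ i)).restrictScalars k ⊓ F m =
          ⨆ i : Fin t,
            if d i ≤ m then
              Submodule.map (LinearMap.mulRight k (g i - μ i)) (F (m - d i))
            else ⊥) ∧
      (grLeftIdeal F π (Submodule.span U (Set.range fun i => g i - μ i)) =
          (Submodule.span B (Set.range fun i => π (d i) ⟨g i, hdF i⟩)).restrictScalars k ∧
        Submodule.span U (Set.range fun i => g i - μ i) ≠ ⊤) ∧
      (∃ (M : Type v) (_ : AddCommGroup M) (_ : Module U M) (m : M),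
        IsSimpleModule U M ∧ Submodule.span U {m} = ⊤ ∧ ∀ i, g i • m = μ i • m) ∧
      (∀ ν : ↥(Algebra.adjoin k (Set.range g)) →ₐ[k] k,
        ∃ (M : Type v) (_ : AddCommGroup M) (_ : Module U M) (m : M),
          IsSimpleModule U M ∧ Submodule.span U {m} = ⊤ ∧
            ∀ γ : ↥(Algebra.adjoin k (Set.range g)),
              (γ : U) • m = (algebraMap k U (ν γ)) • m) := by
  have ha := fun i => sub_mem_symbolGraph hF hπ (hdpos i) (hdF i) (hμ i)
  have hproper := span_ne_top hF hπ ha hcommμ hCI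
  refine ⟨span_inf_filtration hF hπ ha hcommμ hCI,
    ⟨grLeftIdeal_span hF hπ ha hcommμ hCI, hproper⟩, ?_, fun ν => ?_⟩
  · obtain ⟨M, _, _, m, hM, hgen, hm⟩ := exists_simple_of_ne_top hproper
    refine ⟨M, _, _, m, hM, hgen, fun i => ?_⟩
    rw [← sub_eq_zero, ← sub_smul]
    exact hm _ (Submodule.subset_span ⟨i, rfl⟩)
  · let c : Fin t → U := fun i => algebraMap k U (ν ⟨g i, Algebra.subset_adjoin ⟨i, rfl⟩⟩)
    have hc : ∀ i, c i ∈ F (d i - 1) := fun i =>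
      hF.mono (Nat.zero_le _) (hF.zero ▸ Submodule.algebraMap_mem _)
    have hcommc : ∀ i j, Commute (g i - c i) (g j - c j) := fun i j =>
      ((hcomm i j).sub_left (Algebra.commute_algebraMap_left _ _)).sub_right
        (Algebra.commute_algebraMap_right _ _)
    obtain ⟨M, _, _, m, hM, hgen, hm⟩ := exists_simple_of_ne_top
      (span_ne_top hF hπ (fun i => sub_mem_symbolGraph hF hπ (hdpos i) (hdF i) (hc i))
        hcommc hCI)
    refine ⟨M, _, _, m, hM, hgen, smul_eq_of_character ν fun i => ?_⟩
    rw [← sub_eq_zero, ← sub_smul]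
    exact hm _ (Submodule.subset_span ⟨i, rfl⟩)

end
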